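/- arXiv:1008.3443 — 2 statements merged into one kernel-verified Lean document; each statement's English description precedes it below -/
import Mathlib

section
/- Let t > 0 and let 𝒞 be any partition of V. For each C ∈ 𝒞, let 𝒟_C be the partition of C given by the connected components of the induced subgraph G(C), and let 𝒟 = ∪_{C∈𝒞} 𝒟_C be the resulting partition of V. Then 𝒟 is internally connected and Q_t(𝒟) ≥ Q_t(𝒞). -/
open Finset

variable {V : Type*} [Fintype V] [DecidableEq V]

noncomputable section

/-- `Z = ∑_{l,r} m(l,r)` as a real number. -/
def Zval (m : V → V → ℕ) : ℝ := ∑ l : V, ∑ r : V, (m l r : ℝ)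

/-- The probability measure `m_E` on `V × V`. -/
def mE (m : V → V → ℕ) (S : Finset (V × V)) : ℝ :=
  (∑ p ∈ S, (m p.1 p.2 : ℝ)) / Zval m

/-- The marginal probability `m_V` on `V`. -/
def mV (m : V → V → ℕ) (A : Finset V) : ℝ := mE m (A ×ˢ Finset.univ)

/-- The product measure `m_VV` on `V × V`. -/
def mVV (m : V → V → ℕ) (S : Finset (V × V)) : ℝ :=
  ∑ p ∈ S, mV m {p.1} * mV m {p.2}

/-- The signed measure `μ_t = m_E - t · m_VV`. -/
def mu (m : V → V → ℕ) (t : ℝ) (S : Finset (V × V)) : ℝ := mE m S - t * mVV m S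

/-- `ρ(C) = m_E(C × (V ∖ C))`. -/
def rho (m : V → V → ℕ) (C : Finset V) : ℝ := mE m (C ×ˢ (Finset.univ \ C))

/-- A partition of `V`: pairwise disjoint nonempty sets covering `V`. -/
def IsPartition (𝒞 : Finset (Finset V)) : Prop :=
  (∀ C ∈ 𝒞, C.Nonempty) ∧
  (∀ C ∈ 𝒞, ∀ C' ∈ 𝒞, C ≠ C' → Disjoint C C') ∧
  𝒞.sup id = Finset.univ

/-- The diagonal set `D(𝒞) = ∪_{C ∈ 𝒞} C × C`. -/
def Dset (𝒞 : Finset (Finset V)) : Finset (V × V) := 𝒞.sup fun C => C ×ˢ C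

/-- The modularity at resolution `t`: `Q_t(𝒞) = μ_t(D(𝒞))`. -/
def Qmod (m : V → V → ℕ) (t : ℝ) (𝒞 : Finset (Finset V)) : ℝ := mu m t (Dset 𝒞)

/-- The complement `Q̄_t(𝒞) = μ_t(D̄(𝒞))`. -/
def Qbar (m : V → V → ℕ) (t : ℝ) (𝒞 : Finset (Finset V)) : ℝ :=
  mu m t (Finset.univ \ Dset 𝒞)

/-- `𝒞` is submodular for `μ_t`: `μ_t(C × C') ≤ 0` for distinct `C, C' ∈ 𝒞`. -/
def Submodular (m : V → V → ℕ) (t : ℝ) (𝒞 : Finset (Finset V)) : Prop :=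
  ∀ C ∈ 𝒞, ∀ C' ∈ 𝒞, C ≠ C' → mu m t (C ×ˢ C') ≤ 0

/-- `Coarsens 𝒞 𝒟` means `𝒞 ⪯ 𝒟`, i.e. `𝒟` refines `𝒞`:
every element of `𝒞` is the union of the elements of `𝒟` it contains. -/
def Coarsens (𝒞 𝒟 : Finset (Finset V)) : Prop :=
  ∀ C ∈ 𝒞, C = (𝒟.filter fun D => D ⊆ C).sup id

/-- The resolution `t(𝒞)`: the maximum of `m_E(C×C') / m_VV(C×C')` over distinct
pairs of parts (`0` when there are no such pairs, e.g. `|𝒞| = 1`). -/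
def resol (m : V → V → ℕ) (𝒞 : Finset (Finset V)) : ℝ :=
  ⨆ p : {p : Finset V × Finset V // p.1 ∈ 𝒞 ∧ p.2 ∈ 𝒞 ∧ p.1 ≠ p.2},
    mE m ((p : Finset V × Finset V).1 ×ˢ (p : Finset V × Finset V).2) /
      mVV m ((p : Finset V × Finset V).1 ×ˢ (p : Finset V × Finset V).2)

/-- The graph `G` associated to `m`: an edge between `l ≠ r` iff `m(l,r) > 0`
(for symmetric `m` this is exactly the graph of the paper). -/
def graphOf (m : V → V → ℕ) : SimpleGraph V :=
  SimpleGraph.fromRel fun l r => 0 < m l r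

/-- `α(𝒞) = m_VV(D(𝒞)) = ∑_{C ∈ 𝒞} m_V(C)²`. -/
def alphaP (m : V → V → ℕ) (𝒞 : Finset (Finset V)) : ℝ := mVV m (Dset 𝒞)

open scoped Classical in
/-- `Z₀(𝒞)` at resolution `t`: the pairs of distinct parts with `μ_t(C × C') = 0`. -/
def Z0 (m : V → V → ℕ) (t : ℝ) (𝒞 : Finset (Finset V)) :
    Finset (Finset V × Finset V) :=
  (𝒞 ×ˢ 𝒞).filter fun p => p.1 ≠ p.2 ∧ mu m t (p.1 ×ˢ p.2) = 0

/-- The value `c*` of the minimum cut of `G` with weights `m`. -/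
def mincut (m : V → V → ℕ) : ℝ :=
  ⨅ S : {S : Finset V // S.Nonempty ∧ S ≠ Finset.univ},
    ∑ l ∈ (S : Finset V), ∑ r ∈ Finset.univ \ (S : Finset V), (m l r : ℝ)

end

theorem mem_Dset {α : Type*} [DecidableEq α] (𝒞 : Finset (Finset α)) (p : α × α) :
    p ∈ Dset 𝒞 ↔ ∃ C ∈ 𝒞, p.1 ∈ C ∧ p.2 ∈ C := by
  simp [Dset, Finset.mem_sup]

theorem mE_nonneg {α : Type*} [Fintype α] (m : α → α → ℕ) (S : Finset (α × α)) : 0 ≤ mE m S := by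
  unfold mE Zval
  positivity

theorem mVV_mono {α : Type*} [Fintype α] (m : α → α → ℕ) {S T : Finset (α × α)}
    (h : S ⊆ T) : mVV m S ≤ mVV m T :=
  Finset.sum_le_sum_of_subset_of_nonneg h fun _ _ _ =>
    mul_nonneg (mE_nonneg m _) (mE_nonneg m _)

theorem mE_eq_of_subset {α : Type*} [Fintype α] (m : α → α → ℕ)
    {S T : Finset (α × α)} (h : S ⊆ T) (h0 : ∀ p ∈ T, p ∉ S → m p.1 p.2 = 0) : mE m S = mE m T := by
  unfold mE
  rw [Finset.sum_subset h fun p hp hp' => by simp [h0 p hp hp']]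

/-- A connected set meeting a set with no edge leaving it inside `C` is contained in it. -/
theorem subset_of_connected_of_closed {α : Type*} {m : α → α → ℕ}
    (hsym : ∀ l r, m l r = m r l)
    {C D E : Finset α} (hDC : D ⊆ C) (hD : ((graphOf m).induce (D : Set α)).Connected)
    (hE : ∀ l ∈ E, ∀ r ∈ C, r ∉ E → m l r = 0) {x : α} (hxD : x ∈ D) (hxE : x ∈ E) :
    D ⊆ E := by
  intro y hy
  have hr := hD.preconnected ⟨x, hxD⟩ ⟨y, hy⟩
  rw [SimpleGraph.reachable_iff_reflTransGen] at hr
  suffices h : ∀ z : (D : Set α), Relation.ReflTransGen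
      ((graphOf m).induce (D : Set α)).Adj ⟨x, hxD⟩ z → (z : α) ∈ E from h _ hr
  intro z hz
  induction hz with
  | refl => exact hxE
  | @tail b c _ hbc ih =>
    by_contra hc
    have h0 := hE _ ih _ (hDC c.2) hc
    have h1 := hsym (b : α) c
    simp only [SimpleGraph.comap_adj, graphOf, SimpleGraph.fromRel_adj,
      Function.Embedding.subtype_apply] at hbc
    omega

/-- Every point of `C` lies in a connected component of the graph induced on `C`. -/
theorem exists_connected_closed {α : Type*} [DecidableEq α] (m : α → α → ℕ)
    {C : Finset α} {x : α} (hx : x ∈ C) :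
    ∃ D ⊆ C, x ∈ D ∧ ((graphOf m).induce (D : Set α)).Connected ∧
      ∀ l ∈ D, ∀ r ∈ C, r ∉ D → m l r = 0 := by
  classical
  obtain ⟨D, hD, hmax⟩ := (C.powerset.filter fun D : Finset α =>
      x ∈ D ∧ ((graphOf m).induce (D : Set α)).Connected).exists_max_image Finset.card
    ⟨{x}, by
      rw [Finset.mem_filter, Finset.mem_powerset, Finset.singleton_subset_iff,
        Finset.coe_singleton]
      exact ⟨hx, Finset.mem_singleton_self x, ⟨.of_subsingleton⟩⟩⟩
  simp only [Finset.mem_filter, Finset.mem_powerset] at hD hmax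
  obtain ⟨hDC, hxD, hconn⟩ := hD
  refine ⟨D, hDC, hxD, hconn, fun l hl r hr hrD => ?_⟩
  by_contra hne
  have hadj : (graphOf m).Adj l r := by
    rw [graphOf, SimpleGraph.fromRel_adj]
    exact ⟨fun h => hrD (h ▸ hl), Or.inl (Nat.pos_of_ne_zero hne)⟩
  have hins : ((graphOf m).induce ((insert r D : Finset α) : Set α)).Connected := by
    have hunion := SimpleGraph.induce_union_connected hconn.preconnected
      (SimpleGraph.induce_pair_connected_of_adj hadj).preconnected ⟨l, hl, by simp⟩
    have heq : ((insert r D : Finset α) : Set α) = (D : Set α) ∪ {l, r} := by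
      ext y
      simp only [Finset.coe_insert, Set.mem_insert_iff, Set.mem_union,
        Set.mem_singleton_iff, Finset.mem_coe]
      grind
    rwa [heq]
  have := hmax (insert r D)
    ⟨Finset.insert_subset hr hDC, Finset.mem_insert_of_mem hxD, hins⟩
  rw [Finset.card_insert_of_notMem hrD] at this
  omega

/-- Let `t > 0` and `𝒞` be a partition of `V`. If `𝒟` consists
exactly of the connected components of the induced subgraphs `G(C)`, `C ∈ 𝒞`,
then `𝒟` is an internally connected partition of `V` and `Q_t(𝒟) ≥ Q_t(𝒞)`. -/
theorem stmt_5 (m : V → V → ℕ) (hsym : ∀ l r, m l r = m r l)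
    (hZ : 0 < ∑ l : V, ∑ r : V, m l r) (hdeg : ∀ l : V, 0 < ∑ r : V, m l r)
    (t : ℝ) (ht : 0 < t) (𝒞 : Finset (Finset V)) (h𝒞 : IsPartition 𝒞)
    (𝒟 : Finset (Finset V))
    (h𝒟 : ∀ D : Finset V, D ∈ 𝒟 ↔
      ∃ C ∈ 𝒞, D.Nonempty ∧ D ⊆ C ∧
        ((graphOf m).induce (D : Set V)).Connected ∧
        (∀ l ∈ D, ∀ r ∈ C, r ∉ D → m l r = 0)) :
    IsPartition 𝒟 ∧ (∀ D ∈ 𝒟, ((graphOf m).induce (D : Set V)).Connected) ∧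
      Qmod m t 𝒞 ≤ Qmod m t 𝒟 := by
  obtain ⟨-, hdisj, hcov⟩ := h𝒞
  have hpart : ∀ {C C' : Finset V} {x : V}, C ∈ 𝒞 → C' ∈ 𝒞 → x ∈ C → x ∈ C' → C = C' := by
    intro C C' x hC hC' hx hx'
    by_contra hne
    exact Finset.disjoint_left.1 (hdisj C hC C' hC' hne) hx hx'
  have hcover : ∀ x, ∃ C ∈ 𝒞, ∃ D ∈ 𝒟, D ⊆ C ∧ x ∈ D ∧
      ∀ l ∈ D, ∀ r ∈ C, r ∉ D → m l r = 0 := by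
    intro x
    have hx : x ∈ 𝒞.sup id := hcov ▸ Finset.mem_univ x
    obtain ⟨C, hC, hxC⟩ := Finset.mem_sup.1 hx
    obtain ⟨D, hDC, hxD, hconn, hcl⟩ := exists_connected_closed m hxC
    exact ⟨C, hC, D, (h𝒟 D).2 ⟨C, hC, ⟨x, hxD⟩, hDC, hconn, hcl⟩, hDC, hxD, hcl⟩
  refine ⟨⟨fun D hD => ?_, fun D hD D' hD' hne => ?_, ?_⟩, fun D hD => ?_, ?_⟩
  · obtain ⟨_, _, h, _⟩ := (h𝒟 D).1 hD
    exact h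
  · obtain ⟨C, hC, _, hDC, hconn, hcl⟩ := (h𝒟 D).1 hD
    obtain ⟨C', hC', _, hDC', hconn', hcl'⟩ := (h𝒟 D').1 hD'
    refine Finset.disjoint_left.2 fun x hx hx' => hne ?_
    obtain rfl := hpart hC hC' (hDC hx) (hDC' hx')
    exact (subset_of_connected_of_closed hsym hDC hconn hcl' hx hx').antisymm
      (subset_of_connected_of_closed hsym hDC' hconn' hcl hx' hx)
  · refine Finset.eq_univ_iff_forall.2 fun x => ?_
    obtain ⟨_, _, D, hD, _, hxD, _⟩ := hcover x
    exact Finset.mem_sup.2 ⟨D, hD, hxD⟩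
  · obtain ⟨_, _, _, _, h, _⟩ := (h𝒟 D).1 hD
    exact h
  · have hsub : Dset 𝒟 ⊆ Dset 𝒞 := by
      intro p hp
      obtain ⟨D, hD, h1, h2⟩ := (mem_Dset 𝒟 p).1 hp
      obtain ⟨C, hC, _, hDC, _⟩ := (h𝒟 D).1 hD
      exact (mem_Dset 𝒞 p).2 ⟨C, hC, hDC h1, hDC h2⟩
    have hE : mE m (Dset 𝒟) = mE m (Dset 𝒞) := by
      refine mE_eq_of_subset m hsub fun p hp hp' => ?_
      obtain ⟨C, hC, h1, h2⟩ := (mem_Dset 𝒞 p).1 hp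
      obtain ⟨C', hC', D, hD, hDC, hpD, hcl⟩ := hcover p.1
      obtain rfl := hpart hC hC' h1 (hDC hpD)
      exact hcl _ hpD _ h2 fun h => hp' ((mem_Dset 𝒟 p).2 ⟨D, hD, hpD, h⟩)
    have hVV := mul_le_mul_of_nonneg_left (mVV_mono m hsub) ht.le
    unfold Qmod mu
    linarith
end

section
/- Let 𝒞 be a partition of V that is submodular for μ_t (t > 0) with |𝒞| ≥ 2, assume the graph G (with edge (l,r) iff m(l,r)>0) is connected, and let c* be the minimum over nonempty proper subsets S ⊂ V of Σ_{l∈S, r∉S} m(l,r). Then for every C ∈ 𝒞, (m_V(C) − 1/2)² ≤ 1/4 − c*/(tZ), and also (1/|𝒞| − 1/2)² ≤ 1/4 − c*/(tZ). -/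
open Finset

variable {V : Type*} [Fintype V] [DecidableEq V]

theorem mV_eq_sum_singleton (m : V → V → ℕ) (A : Finset V) :
    mV m A = ∑ l ∈ A, mV m {l} := by
  simp only [mV, mE, Finset.sum_product, Finset.sum_singleton, Finset.sum_div]

theorem mV_univ (m : V → V → ℕ) (hZ : 0 < Zval m) : mV m Finset.univ = 1 := by
  simp only [mV, mE, Finset.sum_product]
  exact div_self hZ.ne'

theorem mVV_product (m : V → V → ℕ) (A B : Finset V) :
    mVV m (A ×ˢ B) = mV m A * mV m B := by
  rw [mV_eq_sum_singleton m A, mV_eq_sum_singleton m B, Finset.sum_mul_sum, mVV,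
    Finset.sum_product]

theorem mu_biUnion_right (m : V → V → ℕ) (t : ℝ) (A : Finset V) (𝒟 : Finset (Finset V))
    (h𝒟 : (𝒟 : Set (Finset V)).PairwiseDisjoint id) :
    mu m t (A ×ˢ 𝒟.biUnion id) = ∑ D ∈ 𝒟, mu m t (A ×ˢ D) := by
  have key (B : Finset V) : mu m t (A ×ˢ B) =
      ∑ r ∈ B, ((∑ l ∈ A, (m l r : ℝ)) / Zval m - t * (mV m A * mV m {r})) := by
    rw [mu, mVV_product, mV_eq_sum_singleton m B, mE, Finset.sum_product_right,
      Finset.sum_sub_distrib, Finset.sum_div, Finset.mul_sum, Finset.mul_sum]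
  simp only [key]
  exact Finset.sum_biUnion h𝒟

theorem IsPartition.pairwiseDisjoint {𝒞 : Finset (Finset V)} (h : IsPartition 𝒞) :
    (𝒞 : Set (Finset V)).PairwiseDisjoint id :=
  fun C hC D hD hCD => h.2.1 C hC D hD hCD

theorem IsPartition.biUnion_eq_univ {𝒞 : Finset (Finset V)} (h : IsPartition 𝒞) :
    𝒞.biUnion id = Finset.univ := by
  rw [← Finset.sup_eq_biUnion]
  exact h.2.2

theorem IsPartition.univ_sdiff {𝒞 : Finset (Finset V)} (h : IsPartition 𝒞) {C : Finset V}
    (hC : C ∈ 𝒞) : Finset.univ \ C = (𝒞.erase C).biUnion id := by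
  have hdisj : Disjoint C ((𝒞.erase C).biUnion id) := by
    rw [Finset.disjoint_biUnion_right]
    intro D hD
    exact h.2.1 C hC D (Finset.mem_of_mem_erase hD) (Finset.ne_of_mem_erase hD).symm
  rw [← h.biUnion_eq_univ, ← Finset.insert_erase hC, Finset.biUnion_insert,
    Finset.erase_insert (Finset.notMem_erase C 𝒞)]
  exact Finset.union_sdiff_cancel_left hdisj

theorem IsPartition.sum_mV {𝒞 : Finset (Finset V)} (h : IsPartition 𝒞) (m : V → V → ℕ)
    (hZ : 0 < Zval m) : ∑ C ∈ 𝒞, mV m C = 1 := by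
  rw [← mV_univ m hZ, ← h.biUnion_eq_univ, mV_eq_sum_singleton m (𝒞.biUnion id),
    Finset.sum_biUnion h.pairwiseDisjoint]
  exact Finset.sum_congr rfl fun C _ => mV_eq_sum_singleton m C

theorem IsPartition.ne_univ {𝒞 : Finset (Finset V)} (h : IsPartition 𝒞) (hcard : 2 ≤ 𝒞.card)
    {C : Finset V} (hC : C ∈ 𝒞) : C ≠ Finset.univ := by
  rintro rfl
  obtain ⟨D, hD, hne⟩ := Finset.exists_mem_ne hcard Finset.univ
  obtain ⟨x, hx⟩ := h.1 D hD
  exact Finset.disjoint_left.1 (h.2.1 D hD _ hC hne) hx (Finset.mem_univ x)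

theorem mincut_le (m : V → V → ℕ) {S : Finset V} (hS : S.Nonempty) (hS' : S ≠ Finset.univ) :
    mincut m ≤ ∑ l ∈ S, ∑ r ∈ Finset.univ \ S, (m l r : ℝ) :=
  ciInf_le (Set.finite_range
    (fun S : {S : Finset V // S.Nonempty ∧ S ≠ Finset.univ} =>
      ∑ l ∈ (S : Finset V), ∑ r ∈ Finset.univ \ (S : Finset V), (m l r : ℝ))).bddBelow
    ⟨S, hS, hS'⟩

/-- The boundary of a part of a submodular partition bounds the minimum cut. -/
theorem Submodular.mincut_div_le {m : V → V → ℕ} {t : ℝ} {𝒞 : Finset (Finset V)}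
    (hsub : Submodular m t 𝒞) (h𝒞 : IsPartition 𝒞) (ht : 0 < t) (hZ : 0 < Zval m)
    (hcard : 2 ≤ 𝒞.card) {C : Finset V} (hC : C ∈ 𝒞) :
    mincut m / (t * Zval m) ≤ mV m C * (1 - mV m C) := by
  have hmu : mu m t (C ×ˢ (Finset.univ \ C)) ≤ 0 := by
    rw [h𝒞.univ_sdiff hC, mu_biUnion_right]
    · exact Finset.sum_nonpos fun D hD => hsub C hC D (Finset.mem_of_mem_erase hD)
        (Finset.ne_of_mem_erase hD).symm
    · exact h𝒞.pairwiseDisjoint.subset (Finset.coe_subset.2 (Finset.erase_subset C 𝒞))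
  have hcompl : mV m (Finset.univ \ C) = 1 - mV m C := by
    rw [← mV_univ m hZ, mV_eq_sum_singleton m (Finset.univ \ C), mV_eq_sum_singleton m C,
      mV_eq_sum_singleton m Finset.univ, eq_sub_iff_add_eq]
    exact Finset.sum_sdiff (Finset.subset_univ C)
  rw [mu, mVV_product, hcompl, mE, Finset.sum_product, sub_nonpos, div_le_iff₀ hZ] at hmu
  rw [div_le_iff₀ (mul_pos ht hZ)]
  calc mincut m ≤ _ := mincut_le m (h𝒞.1 C hC) (h𝒞.ne_univ hcard hC)
    _ ≤ _ := hmu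
    _ = _ := by ring

/-- If `𝒞` is a partition of `V` submodular for `μ_t` (`t > 0`)
with `|𝒞| ≥ 2`, `G` is connected and `c*` is the minimum cut value, then for every
`C ∈ 𝒞`, `(m_V(C) − 1/2)² ≤ 1/4 − c*/(tZ)`, and `(1/|𝒞| − 1/2)² ≤ 1/4 − c*/(tZ)`. -/
theorem stmt_13 (m : V → V → ℕ) (hsym : ∀ l r, m l r = m r l)
    (hZ : 0 < ∑ l : V, ∑ r : V, m l r) (hdeg : ∀ l : V, 0 < ∑ r : V, m l r)
    (𝒞 : Finset (Finset V)) (h𝒞 : IsPartition 𝒞) (t : ℝ) (ht : 0 < t)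
    (hsub : Submodular m t 𝒞) (hcard : 2 ≤ 𝒞.card)
    (hconn : (graphOf m).Connected) :
    (∀ C ∈ 𝒞, (mV m C - 1 / 2) ^ 2 ≤ 1 / 4 - mincut m / (t * Zval m)) ∧
    ((1 / (𝒞.card : ℝ) - 1 / 2) ^ 2 ≤ 1 / 4 - mincut m / (t * Zval m)) := by
  have hZ' : 0 < Zval m := by
    rw [Zval]
    exact_mod_cast hZ
  have hpart (C : Finset V) (hC : C ∈ 𝒞) :=
    hsub.mincut_div_le h𝒞 ht hZ' hcard hC
  refine ⟨fun C hC => by linarith [hpart C hC], ?_⟩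
  have hk : (0 : ℝ) < 𝒞.card := by exact_mod_cast (by omega : 0 < 𝒞.card)
  have hsum := h𝒞.sum_mV m hZ'
  have hsq := sq_sum_le_card_mul_sum_sq (s := 𝒞) (f := fun C => mV m C)
  have havg : 𝒞.card * (mincut m / (t * Zval m)) ≤ 1 - ∑ C ∈ 𝒞, mV m C ^ 2 := by
    rw [← hsum, ← Finset.sum_sub_distrib, ← nsmul_eq_mul]
    refine Finset.card_nsmul_le_sum _ _ _ fun C hC => (hpart C hC).trans_eq ?_
    ring
  rw [hsum, one_pow] at hsq
  have hle : 1 / (𝒞.card : ℝ) ≤ ∑ C ∈ 𝒞, mV m C ^ 2 := by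
    rwa [div_le_iff₀' hk]
  have hfinal : mincut m / (t * Zval m) ≤ (1 - 1 / (𝒞.card : ℝ)) * (1 / 𝒞.card) := by
    rw [mul_one_div, le_div_iff₀' hk]
    linarith
  linarith
end
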